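/- arXiv:0906.1947 — 2 statements merged into one kernel-verified Lean document; each statement's English description precedes it below -/
import Mathlib

section
/- In the conflict manager CM: (a) for the process j* whose identifier is maximal among all N processes, in(j*) = access(j*) in every state; (b) in every state in which at least one process has access = true, at least one process has in = true (namely, the process with the largest identifier among those with access = true). -/
/-- Conflict manager `CM` on a chain of `N` processes (indices `1..N`),
with injective identifiers `id'` and state `access : ℕ → Bool`.
The output variable `inCS j` holds iff `access j = true` and `j` has the
highest identifier among its neighbors whose `access` is `true`.
(a) For the process `jstar` with maximal identifier among all processes,
`inCS jstar` holds iff `access jstar = true`.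
(b) If some process has `access = true`, then some process has `inCS` true. -/
theorem cm_progress (N : ℕ) (hN : 1 ≤ N)
    (id' : ℕ → ℕ)
    (hinj : ∀ a b, 1 ≤ a → a ≤ N → 1 ≤ b → b ≤ N → id' a = id' b → a = b)
    (access : ℕ → Bool)
    (inCS : ℕ → Prop)
    (hin : ∀ j, 1 ≤ j → j ≤ N →
      (inCS j ↔ access j = true ∧
        ∀ k, 1 ≤ k → k ≤ N → (k + 1 = j ∨ k = j + 1) → access k = true →
          id' k < id' j)) :
    (∀ jstar, 1 ≤ jstar → jstar ≤ N →
      (∀ k, 1 ≤ k → k ≤ N → id' k ≤ id' jstar) →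
      (inCS jstar ↔ access jstar = true)) ∧
    ((∃ j, 1 ≤ j ∧ j ≤ N ∧ access j = true) →
      ∃ j, 1 ≤ j ∧ j ≤ N ∧ inCS j) := by
  constructor
  · intro j h1 h2 hmax
    rw [hin j h1 h2]
    refine ⟨fun h => h.1, fun h => ⟨h, fun k hk1 hk2 hn _ => ?_⟩⟩
    refine lt_of_le_of_ne (hmax k hk1 hk2) fun he => ?_
    have := hinj k j hk1 hk2 h1 h2 he
    omega
  · rintro ⟨j0, h1, h2, ha⟩
    obtain ⟨j, hj, hmax⟩ := Finset.exists_max_image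
      ((Finset.Icc 1 N).filter (fun j => access j = true)) id'
      ⟨j0, by simp [h1, h2, ha]⟩
    simp only [Finset.mem_filter, Finset.mem_Icc] at hj hmax
    obtain ⟨⟨hj1, hj2⟩, hja⟩ := hj
    refine ⟨j, hj1, hj2, (hin j hj1 hj2).2 ⟨hja, fun k hk1 hk2 hn hka => ?_⟩⟩
    refine lt_of_le_of_ne (hmax k ⟨⟨hk1, hk2⟩, hka⟩) fun he => ?_
    have := hinj k j hk1 hk2 hj1 hj2 he
    omega
end

section
/- The linear alternator LA is deadlock-free: for every state x : {1,…,N} → Bool (N ≥ 2), at least one process is enabled. -/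
/-- Process `j` of the linear alternator on a chain of `N` processes is enabled
in state `x`. -/
def laEnabled (N : ℕ) (x : ℕ → Bool) (j : ℕ) : Prop :=
  (j = 1 ∧ x 1 = x 2) ∨
  (1 < j ∧ j < N ∧ x (j - 1) ≠ x j ∧ x j = x (j + 1)) ∨
  (j = N ∧ x (N - 1) ≠ x N)

/-- The linear alternator is deadlock-free: in every state at least one process
is enabled. -/
theorem la_deadlock_free (N : ℕ) (hN : 2 ≤ N) (x : ℕ → Bool) :
    ∃ j, 1 ≤ j ∧ j ≤ N ∧ laEnabled N x j := by
  by_contra hcon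
  have key : ∀ k, k + 2 ≤ N → x (k + 1) ≠ x (k + 2) := by
    intro k
    induction k with
    | zero =>
      intro _ he
      exact hcon ⟨1, le_refl 1, by omega, Or.inl ⟨rfl, he⟩⟩
    | succ k ih =>
      intro hk he
      exact hcon ⟨k + 2, by omega, by omega,
        Or.inr (Or.inl ⟨by omega, by omega, ih (by omega), he⟩)⟩
  obtain ⟨m, rfl⟩ : ∃ m, N = m + 2 := ⟨N - 2, by omega⟩
  exact hcon ⟨m + 2, by omega, le_refl _, Or.inr (Or.inr ⟨rfl, key m (le_refl _)⟩)⟩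
end
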